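/- arXiv:1510.01492 — 3 statements merged into one kernel-verified Lean document; each statement's English description precedes it below -/
import Mathlib

section
/- Consider the Yang system ẋ = σ(y − x), ẏ = r x − x z, ż = −b z + x y with real parameters σ > 0, b > 0 and r = 0. Assume b(σ − b) > 0 and σ − (σ + b)²/(4(σ − b)) ≥ 0. Then every solution (x(t), y(t), z(t)) of the system that is bounded on [0, +∞) tends, as t → +∞, to some equilibrium point of the system, i.e. to a point (x*, y*, z*) with σ(y* − x*) = 0, r x* − x* z* = 0, and −b z* + x* y* = 0. -/
open Filter

/-- Barbalat's lemma: if `f` converges and its second derivative is bounded, `f'` tends to `0`. -/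
theorem tendsto_deriv_zero_of_bounded_second_deriv {f f' f'' : ℝ → ℝ} {L K : ℝ}
    (hf : ∀ t, 0 ≤ t → HasDerivAt f (f' t) t) (hf' : ∀ t, 0 ≤ t → HasDerivAt f' (f'' t) t)
    (hK : ∀ t, 0 ≤ t → |f'' t| ≤ K) (hL : Tendsto f atTop (nhds L)) :
    Tendsto f' atTop (nhds 0) := by
  have hK0 : 0 ≤ K := (abs_nonneg _).trans (hK 0 le_rfl)
  rw [Metric.tendsto_atTop]
  intro ε hε
  set δ : ℝ := ε / (2 * (K + 1)) with hδ
  have hδ0 : 0 < δ := by positivity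
  have hKδ : K * δ < ε / 2 := by
    have : (K + 1) * δ = ε / 2 := by rw [hδ]; field_simp
    nlinarith
  have hdiff : Tendsto (fun t => (f (t + δ) - f t) / δ) atTop (nhds 0) := by
    have := ((hL.comp (tendsto_atTop_add_const_right _ δ tendsto_id)).sub hL).div_const δ
    simpa using this
  obtain ⟨N, hN⟩ := Metric.tendsto_atTop.1 hdiff (ε / 2) (by positivity)
  refine ⟨max N 0, fun t ht => ?_⟩
  have ht0 : 0 ≤ t := (le_max_right _ _).trans ht
  obtain ⟨s, ⟨hts, hst⟩, hs⟩ := exists_hasDerivAt_eq_slope f f' (by linarith : t < t + δ)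
    (fun u hu => (hf u (ht0.trans hu.1)).continuousAt.continuousWithinAt)
    (fun u hu => hf u (ht0.trans hu.1.le))
  have h_slope := hN t ((le_max_left _ _).trans ht)
  rw [Real.dist_eq, sub_zero] at h_slope ⊢
  rw [add_sub_cancel_left] at hs
  rw [← hs] at h_slope
  have h_lip : |f' t - f' s| ≤ K * |t - s| :=
    (convex_Ici (0 : ℝ)).norm_image_sub_le_of_norm_hasDerivWithin_le
      (fun u hu => (hf' u hu).hasDerivWithinAt) hK (Set.mem_Ici.2 (ht0.trans hts.le)) ht0
  have h_abs : |t - s| ≤ δ := by rw [abs_le]; constructor <;> linarith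
  have h_tri : |f' t| ≤ |f' t - f' s| + |f' s| := by
    simpa using abs_add_le (f' t - f' s) (f' s)
  nlinarith [mul_le_mul_of_nonneg_left h_abs hK0]

/-- A nonnegative solution of `q' = -a q + g` with `0 < a` and `g → 0` tends to `0`. -/
theorem tendsto_zero_of_hasDerivAt_neg_mul_add {q g : ℝ → ℝ} {a : ℝ} (ha : 0 < a)
    (hq0 : ∀ t, 0 ≤ q t) (hq : ∀ t, 0 ≤ t → HasDerivAt q (-a * q t + g t) t)
    (hg : Tendsto g atTop (nhds 0)) : Tendsto q atTop (nhds 0) := by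
  rw [Metric.tendsto_atTop]
  intro ε hε
  obtain ⟨N, hN⟩ := Metric.tendsto_atTop.1 hg (a * (ε / 2)) (by positivity)
  set T := max N 0
  have hderiv : ∀ t, T ≤ t → HasDerivAt (fun t => (q t - ε / 2) * Real.exp (a * t))
      ((g t - a * (ε / 2)) * Real.exp (a * t)) t := by
    intro t ht
    have h1 := (hq t ((le_max_right _ _).trans ht)).sub_const (ε / 2)
    have h2 := ((hasDerivAt_id t).const_mul a).exp
    refine (h1.mul h2).congr_deriv ?_
    simp only [id]
    ring
  have hanti : AntitoneOn (fun t => (q t - ε / 2) * Real.exp (a * t)) (Set.Ici T) := by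
    refine antitoneOn_of_hasDerivWithinAt_nonpos (convex_Ici T)
      (fun t ht => (hderiv t ht).continuousAt.continuousWithinAt)
      (fun t ht => (hderiv t (interior_subset ht)).hasDerivWithinAt) fun t ht => ?_
    have hgt := hN t ((le_max_left _ _).trans (interior_subset ht))
    rw [Real.dist_eq, sub_zero] at hgt
    exact mul_nonpos_of_nonpos_of_nonneg (by linarith [le_abs_self (g t)]) (Real.exp_pos _).le
  set C := (q T - ε / 2) * Real.exp (a * T)
  have hexp : Tendsto (fun t => C * Real.exp (-(a * t))) atTop (nhds 0) := by
    simpa using ((Real.tendsto_exp_neg_atTop_nhds_zero.comp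
      (tendsto_id.const_mul_atTop ha)).const_mul C)
  obtain ⟨N', hN'⟩ := Metric.tendsto_atTop.1 hexp (ε / 2) (by positivity)
  refine ⟨max N' T, fun t ht => ?_⟩
  have htT : T ≤ t := (le_max_right _ _).trans ht
  have hC : (q t - ε / 2) * Real.exp (a * t) ≤ C := hanti Set.self_mem_Ici htT htT
  have hsmall := hN' t ((le_max_left _ _).trans ht)
  rw [Real.dist_eq, sub_zero] at hsmall ⊢
  have hle : q t - ε / 2 ≤ C * Real.exp (-(a * t)) := by
    rwa [Real.exp_neg, ← div_eq_mul_inv, le_div_iff₀ (Real.exp_pos _)]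
  rw [abs_of_nonneg (hq0 t)]
  linarith [le_abs_self (C * Real.exp (-(a * t)))]

/-- A continuous function is bounded along a curve with bounded range. -/
theorem exists_abs_le_of_isBounded_image {E : Type*} [PseudoMetricSpace E] [ProperSpace E]
    {γ : ℝ → E} (hγ : Bornology.IsBounded (γ '' Set.Ici (0 : ℝ))) {F : E → ℝ}
    (hF : Continuous F) : ∃ K, ∀ t, 0 ≤ t → |F (γ t)| ≤ K := by
  obtain ⟨K, hK⟩ := hγ.isCompact_closure.exists_bound_of_continuousOn hF.continuousOn
  exact ⟨K, fun t ht => hK _ (subset_closure ⟨t, ht, rfl⟩)⟩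

/-- Yang system with r = 0: if b(σ − b) > 0 and σ − (σ+b)²/(4(σ−b)) ≥ 0, every solution
bounded on [0, +∞) tends to an equilibrium as t → +∞. -/
theorem yang_r_zero_convergence
    (σ b r : ℝ) (hσ : 0 < σ) (hb : 0 < b) (hr : r = 0)
    (h1 : 0 < b * (σ - b))
    (h2 : 0 ≤ σ - (σ + b) ^ 2 / (4 * (σ - b)))
    (x y z : ℝ → ℝ)
    (hx : ∀ t : ℝ, 0 ≤ t → HasDerivAt x (σ * (y t - x t)) t)
    (hy : ∀ t : ℝ, 0 ≤ t → HasDerivAt y (r * x t - x t * z t) t)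
    (hz : ∀ t : ℝ, 0 ≤ t → HasDerivAt z (-b * z t + x t * y t) t)
    (hbdd : Bornology.IsBounded ((fun t => (x t, y t, z t)) '' Set.Ici (0 : ℝ))) :
    ∃ p : ℝ × ℝ × ℝ,
      (σ * (p.2.1 - p.1) = 0 ∧ r * p.1 - p.1 * p.2.2 = 0 ∧ -b * p.2.2 + p.1 * p.2.1 = 0) ∧
      Tendsto (fun t => (x t, y t, z t)) atTop (nhds p) := by
  subst hr
  have h_bound {F : ℝ × ℝ × ℝ → ℝ} (hF : Continuous F) := exists_abs_le_of_isBounded_image hbdd hF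
  have hV : ∀ t, 0 ≤ t → HasDerivAt (fun t => y t ^ 2 + z t ^ 2) (-(2 * b) * z t ^ 2) t := by
    intro t ht
    refine (((hy t ht).pow 2).add ((hz t ht).pow 2)).congr_deriv ?_
    push_cast
    ring
  have hV' : ∀ t, 0 ≤ t → HasDerivAt (fun t => -(2 * b) * z t ^ 2)
      (-(4 * b) * z t * (-b * z t + x t * y t)) t := by
    intro t ht
    refine (((hz t ht).pow 2).const_mul (-(2 * b))).congr_deriv ?_
    push_cast
    ring
  have hanti : AntitoneOn (fun t => y t ^ 2 + z t ^ 2) (Set.Ici 0) :=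
    antitoneOn_of_hasDerivWithinAt_nonpos (convex_Ici 0)
      (fun t ht => (hV t ht).continuousAt.continuousWithinAt)
      (fun t ht => (hV t (interior_subset ht)).hasDerivWithinAt)
      (fun t _ => by nlinarith [mul_nonneg hb.le (sq_nonneg (z t))])
  obtain ⟨L, hL⟩ : ∃ L, Tendsto (fun t => y t ^ 2 + z t ^ 2) atTop (nhds L) := by
    have hanti' : Antitone (fun t => y (max t 0) ^ 2 + z (max t 0) ^ 2) := fun s t hst =>
      hanti (le_max_right s 0) (le_max_right t 0) (max_le_max_right 0 hst)
    refine ⟨_, (tendsto_atTop_ciInf hanti' ⟨0, ?_⟩).congr' ?_⟩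
    · rintro _ ⟨t, rfl⟩
      positivity
    · filter_upwards [eventually_ge_atTop 0] with t ht
      rw [max_eq_left ht]
  have hz0 : Tendsto z atTop (nhds 0) := by
    obtain ⟨K, hK⟩ := h_bound
      (F := fun p => -(4 * b) * p.2.2 * (-b * p.2.2 + p.1 * p.2.1)) (by fun_prop)
    have h := (tendsto_deriv_zero_of_bounded_second_deriv hV hV' hK hL).const_mul (-(2 * b))⁻¹
    have hb2 : -(2 * b) ≠ 0 := by simpa using hb.ne'
    simp only [inv_mul_cancel_left₀ hb2, mul_zero] at h
    simpa [Real.sqrt_sq_eq_abs, tendsto_zero_iff_abs_tendsto_zero, Function.comp_def] using h.sqrt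
  have hxy0 : Tendsto (fun t => x t * y t) atTop (nhds 0) := by
    obtain ⟨K, hK⟩ := h_bound
      (F := fun p => -b * (-b * p.2.2 + p.1 * p.2.1) +
        (σ * (p.2.1 - p.1) * p.2.1 + p.1 * (0 * p.1 - p.1 * p.2.2))) (by fun_prop)
    have h := tendsto_deriv_zero_of_bounded_second_deriv hz
      (fun t ht => ((hz t ht).const_mul (-b)).add ((hx t ht).mul (hy t ht))) hK hz0
    simpa using h.add (hz0.const_mul b)
  have hx0 : Tendsto x atTop (nhds 0) := by
    have h := tendsto_zero_of_hasDerivAt_neg_mul_add (q := fun t => x t ^ 2)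
      (g := fun t => 2 * σ * (x t * y t)) (a := 2 * σ) (by positivity) (fun t => sq_nonneg _)
      (fun t ht => ((hx t ht).pow 2).congr_deriv (by push_cast; ring))
      (by simpa using hxy0.const_mul (2 * σ))
    simpa [Real.sqrt_sq_eq_abs, tendsto_zero_iff_abs_tendsto_zero, Function.comp_def] using h.sqrt
  have hy0 : Tendsto y atTop (nhds 0) := by
    obtain ⟨K, hK⟩ := h_bound
      (F := fun p => σ * (0 * p.1 - p.1 * p.2.2 - σ * (p.2.1 - p.1))) (by fun_prop)
    have h := tendsto_deriv_zero_of_bounded_second_deriv hx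
      (fun t ht => ((hy t ht).sub (hx t ht)).const_mul σ) hK hx0
    simpa [hσ.ne'] using (h.const_mul σ⁻¹).add hx0
  exact ⟨(0, 0, 0), by simp, hx0.prodMk_nhds (hy0.prodMk_nhds hz0)⟩
end

section
/- Consider the Yang system ẋ = σ(y − x), ẏ = r x − x z, ż = −b z + x y with real parameters σ > 0, b > 0 and r < 0. Assume r σ + b(σ − b) > 0. Then every solution (x(t), y(t), z(t)) of the system that is bounded on [0, +∞) tends, as t → +∞, to some equilibrium point of the system. -/
open Filter

/-- A function satisfying `f' ≤ -κ f` on `[0, ∞)` with `κ > 0` and bounded below by `0` tends to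
`0`. -/
lemma tendsto_zero_of_deriv_le_neg_mul {f f' : ℝ → ℝ} {κ : ℝ} (hκ : 0 < κ)
    (hf : ∀ t, 0 ≤ t → HasDerivAt f (f' t) t) (hle : ∀ t, 0 ≤ t → f' t ≤ -κ * f t)
    (hnonneg : ∀ t, 0 ≤ f t) : Tendsto f atTop (nhds 0) := by
  have hderiv : ∀ t, 0 ≤ t → HasDerivAt (fun s => Real.exp (κ * s) * f s)
      (Real.exp (κ * t) * (κ * f t + f' t)) t := by
    intro t ht
    have he : HasDerivAt (fun s => Real.exp (κ * s)) (Real.exp (κ * t) * (κ * 1)) t :=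
      ((hasDerivAt_id t).const_mul κ).exp
    exact (he.mul (hf t ht)).congr_deriv (by ring)
  have hanti : AntitoneOn (fun s => Real.exp (κ * s) * f s) (Set.Ici 0) := by
    refine antitoneOn_of_hasDerivWithinAt_nonpos (convex_Ici 0)
      (fun t ht => (hderiv t ht).continuousAt.continuousWithinAt)
      (fun t ht => (hderiv t (interior_subset ht)).hasDerivWithinAt) fun t ht => ?_
    have := hle t (interior_subset ht)
    exact mul_nonpos_of_nonneg_of_nonpos (Real.exp_pos _).le (by linarith)
  have hbound : ∀ t, 0 ≤ t → f t ≤ f 0 * Real.exp (-(κ * t)) := by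
    intro t ht
    have h := hanti (Set.mem_Ici.2 le_rfl) (Set.mem_Ici.2 ht) ht
    simp only [mul_zero, Real.exp_zero, one_mul] at h
    rw [Real.exp_neg, ← div_eq_mul_inv, le_div_iff₀ (Real.exp_pos _)]
    linarith
  have hlim : Tendsto (fun t => f 0 * Real.exp (-(κ * t))) atTop (nhds 0) := by
    have := (Real.tendsto_exp_neg_atTop_nhds_zero.comp
      (tendsto_id.const_mul_atTop hκ)).const_mul (f 0)
    simpa using this
  exact squeeze_zero' (Eventually.of_forall hnonneg)
    ((eventually_ge_atTop 0).mono hbound) hlim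

lemma tendsto_zero_of_mul_sq_le {g V : ℝ → ℝ} {a : ℝ} (ha : 0 < a)
    (hV : Tendsto V atTop (nhds 0)) (h : ∀ t, a * g t ^ 2 ≤ V t) :
    Tendsto g atTop (nhds 0) := by
  have hsq : Tendsto (fun t => g t ^ 2) atTop (nhds 0) := by
    refine squeeze_zero (fun t => sq_nonneg _) (fun t => ?_) (by simpa using hV.div_const a)
    rw [le_div_iff₀ ha]
    linarith [h t]
  have habs : Tendsto (fun t => |g t|) atTop (nhds 0) := by
    simpa [Real.sqrt_sq_eq_abs] using hsq.sqrt
  exact (tendsto_zero_iff_abs_tendsto_zero g).2 habs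

/-- A Lyapunov function for the Yang system in the coordinates `x`, `v = σ (y - x)`,
`u = z - x² / (2σ)`; the parameters `c`, `d` are chosen in terms of `σ`, `b`. -/
noncomputable def yangLyapunov (σ r c d x v u : ℝ) : ℝ :=
  v ^ 2 / 2 - r * σ * x ^ 2 / 2 + x ^ 4 / 8 + σ * u * x ^ 2 / 2 + c * u ^ 2
    + d * (x * v + σ * x ^ 2 / 2)

lemma yangLyapunov_eq (σ r c d x v u : ℝ) :
    yangLyapunov σ r c d x v u = -(r * σ) / 2 * x ^ 2 + 1 / 2 * (v + d * x) ^ 2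
      + d * (σ - d) / 2 * x ^ 2 + (c - σ ^ 2 / 2) * u ^ 2 + 1 / 8 * (x ^ 2 + 2 * σ * u) ^ 2 := by
  unfold yangLyapunov
  ring

lemma yangLyapunov_le {σ r c d : ℝ} (hσ : 0 < σ) (hr : r < 0) (hc : 0 < c) (hd : 0 < d)
    (x v u : ℝ) : yangLyapunov σ r c d x v u ≤
      (1 - r * σ + σ + c + d + d * σ) * (v ^ 2 + x ^ 2 + x ^ 4 + u ^ 2) := by
  have hk : 0 < -(r * σ) := by nlinarith
  have h1 : σ * (u * x ^ 2 / 2) ≤ σ * (u ^ 2 + x ^ 4) := by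
    gcongr
    nlinarith [sq_nonneg (u - x ^ 2), sq_nonneg u, sq_nonneg (x ^ 2)]
  have h2 : d * (x * v) ≤ d * (x ^ 2 + v ^ 2) := by
    gcongr
    nlinarith [sq_nonneg (x - v), sq_nonneg x, sq_nonneg v]
  have hdσ := mul_pos hd hσ
  unfold yangLyapunov
  have e : ∀ p : ℝ, 0 < p → 0 ≤ p * x ^ 2 ∧ 0 ≤ p * v ^ 2 ∧ 0 ≤ p * u ^ 2 ∧ 0 ≤ p * x ^ 4 :=
    fun p hp => ⟨by positivity, by positivity, by positivity, by positivity⟩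
  obtain ⟨a1, a2, a3, a4⟩ := e 1 one_pos
  obtain ⟨b1, b2, b3, b4⟩ := e _ hk
  obtain ⟨c1, c2, c3, c4⟩ := e _ hσ
  obtain ⟨d1, d2, d3, d4⟩ := e _ hc
  obtain ⟨f1, f2, f3, f4⟩ := e _ hd
  obtain ⟨g1, g2, g3, g4⟩ := e _ hdσ
  nlinarith

/-- Yang system with r < 0: if rσ + b(σ − b) > 0, every solution bounded on [0, +∞)
tends to an equilibrium as t → +∞. -/
theorem yang_r_neg_convergence
    (σ b r : ℝ) (hσ : 0 < σ) (hb : 0 < b) (hr : r < 0)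
    (h1 : 0 < r * σ + b * (σ - b))
    (x y z : ℝ → ℝ)
    (hx : ∀ t : ℝ, 0 ≤ t → HasDerivAt x (σ * (y t - x t)) t)
    (hy : ∀ t : ℝ, 0 ≤ t → HasDerivAt y (r * x t - x t * z t) t)
    (hz : ∀ t : ℝ, 0 ≤ t → HasDerivAt z (-b * z t + x t * y t) t)
    (hbdd : Bornology.IsBounded ((fun t => (x t, y t, z t)) '' Set.Ici (0 : ℝ))) :
    ∃ p : ℝ × ℝ × ℝ,
      (σ * (p.2.1 - p.1) = 0 ∧ r * p.1 - p.1 * p.2.2 = 0 ∧ -b * p.2.2 + p.1 * p.2.1 = 0) ∧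
      Tendsto (fun t => (x t, y t, z t)) atTop (nhds p) := by
  have hk : 0 < -(r * σ) := by nlinarith
  have hσb : b < σ := by nlinarith
  have hσb' : 0 < 2 * σ - b := by linarith
  obtain ⟨c, hc⟩ : ∃ c, c * (2 * σ - b) = σ ^ 2 * (σ + b / 4) :=
    ⟨_, div_mul_cancel₀ _ hσb'.ne'⟩
  have hcσ : 0 < c - σ ^ 2 / 2 := by
    refine pos_of_mul_pos_left (b := 2 * σ - b) ?_ hσb'.le
    have : 0 < σ ^ 2 * b := by positivity
    nlinarith
  have hc0 : 0 < c := by nlinarith [sq_nonneg σ]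
  obtain ⟨d, hd⟩ : ∃ d, d = σ - b / 4 := ⟨_, rfl⟩
  have hd0 : 0 < d := by linarith
  have hdσ : 0 < d * (σ - d) := mul_pos hd0 (by linarith)
  set v : ℝ → ℝ := fun t => σ * (y t - x t) with hv
  set u : ℝ → ℝ := fun t => z t - x t ^ 2 / (2 * σ) with hu
  set V : ℝ → ℝ := fun t => yangLyapunov σ r c d (x t) (v t) (u t) with hV
  have hv' : ∀ t, 0 ≤ t → HasDerivAt v (σ * (r * x t - x t * z t - v t)) t :=
    fun t ht => ((hy t ht).sub (hx t ht)).const_mul σ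
  have hu' : ∀ t, 0 ≤ t → HasDerivAt u (-b * z t + x t ^ 2) t := fun t ht =>
    ((hz t ht).sub (((hx t ht).pow 2).div_const (2 * σ))).congr_deriv (by
      field_simp
      ring)
  have hzu : ∀ t, z t = u t + x t ^ 2 / (2 * σ) := fun t => by simp [hu]
  have hV' : ∀ t, 0 ≤ t → HasDerivAt V (-(b / 4 * v t ^ 2 + d * -(r * σ) * x t ^ 2
      + b / 8 * x t ^ 4 + 2 * c * b * u t ^ 2)) t := by
    intro t ht
    have hX : HasDerivAt x (v t) t := hx t ht
    have hU := hu' t ht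
    have hW := hv' t ht
    refine ((((((((hW.pow 2).div_const 2).sub
      (((hX.pow 2).const_mul (r * σ)).div_const 2)).add ((hX.pow 4).div_const 8)).add
      (((hU.const_mul σ).mul (hX.pow 2)).div_const 2)).add ((hU.pow 2).const_mul c)).add
      (((hX.mul hW).add (((hX.pow 2).const_mul σ).div_const 2)).const_mul d))).congr_deriv ?_
    simp only [Pi.pow_apply, hzu t, hd]
    generalize x t = X
    generalize v t = Y
    generalize u t = U
    linear_combination (norm := skip) U * X ^ 2 / σ * hc
    field_simp
    ring
  have hVnonneg : ∀ t, 0 ≤ V t := fun t => by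
    simp only [hV, yangLyapunov_eq]
    positivity
  obtain ⟨m, hm0, hm⟩ : ∃ m, 0 < m ∧ m ≤ b / 4 ∧ m ≤ d * -(r * σ) ∧ m ≤ b / 8 ∧
      m ≤ 2 * c * b := by
    refine ⟨min (min (b / 4) (d * -(r * σ))) (min (b / 8) (2 * c * b)), ?_, ?_⟩
    · have := mul_pos hd0 hk
      refine lt_min (lt_min ?_ this) (lt_min ?_ ?_) <;> positivity
    · simp
  obtain ⟨hm1, hm2, hm3, hm4⟩ := hm
  set M := 1 - r * σ + σ + c + d + d * σ with hM
  have hM0 : 0 < M := by nlinarith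
  have hVlim : Tendsto V atTop (nhds 0) := by
    refine tendsto_zero_of_deriv_le_neg_mul (div_pos hm0 hM0) hV' (fun t _ => ?_) hVnonneg
    have hle : m / M * V t ≤ m * (v t ^ 2 + x t ^ 2 + x t ^ 4 + u t ^ 2) := by
      rw [div_mul_eq_mul_div, div_le_iff₀ hM0, mul_assoc]
      refine mul_le_mul_of_nonneg_left ?_ hm0.le
      rw [mul_comm _ M]
      exact yangLyapunov_le hσ hr hc0 hd0 _ _ _
    have e1 : m * v t ^ 2 ≤ b / 4 * v t ^ 2 := by gcongr
    have e2 : m * x t ^ 2 ≤ d * -(r * σ) * x t ^ 2 := by gcongr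
    have e3 : m * x t ^ 4 ≤ b / 8 * x t ^ 4 := by gcongr
    have e4 : m * u t ^ 2 ≤ 2 * c * b * u t ^ 2 := by gcongr
    linarith
  have hparts : ∀ t, 0 ≤ 1 / 2 * (v t + d * x t) ^ 2 ∧ 0 ≤ -(r * σ) / 2 * x t ^ 2 ∧
      0 ≤ d * (σ - d) / 2 * x t ^ 2 ∧ 0 ≤ (c - σ ^ 2 / 2) * u t ^ 2 ∧
      0 ≤ 1 / 8 * (x t ^ 2 + 2 * σ * u t) ^ 2 := fun t =>
    ⟨by positivity, by positivity, by positivity, by positivity, by positivity⟩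
  have hVeq : ∀ t, V t = _ := fun t => yangLyapunov_eq σ r c d (x t) (v t) (u t)
  have hxlim : Tendsto x atTop (nhds 0) :=
    tendsto_zero_of_mul_sq_le (half_pos hk) hVlim fun t => by
      obtain ⟨p1, p2, p3, p4, p5⟩ := hparts t
      linarith [hVeq t]
  have hwlim : Tendsto (fun t => v t + d * x t) atTop (nhds 0) :=
    tendsto_zero_of_mul_sq_le one_half_pos hVlim fun t => by
      obtain ⟨p1, p2, p3, p4, p5⟩ := hparts t
      linarith [hVeq t]
  have hulim : Tendsto u atTop (nhds 0) :=
    tendsto_zero_of_mul_sq_le hcσ hVlim fun t => by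
      obtain ⟨p1, p2, p3, p4, p5⟩ := hparts t
      linarith [hVeq t]
  have hylim : Tendsto y atTop (nhds 0) := by
    have h := ((hwlim.sub (hxlim.const_mul d)).div_const σ).add hxlim
    simp only [mul_zero, sub_zero, zero_div, add_zero] at h
    refine h.congr fun t => ?_
    simp only [hv]
    field_simp
    ring
  have hzlim : Tendsto z atTop (nhds 0) := by
    have h := hulim.add ((hxlim.pow 2).div_const (2 * σ))
    simp only [ne_eq, OfNat.ofNat_ne_zero, not_false_eq_true, zero_pow, zero_div,
      add_zero] at h
    exact h.congr fun t => (hzu t).symm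
  exact ⟨(0, 0, 0), by simp, hxlim.prodMk_nhds (hylim.prodMk_nhds hzlim)⟩
end

section
/- Let σ > 0, b > 0, r > 0 be real numbers with r σ > b(σ + b). Set λ₁ = (−σ + √(σ² + 4σr))/2, λ₂ = −b, and λ₃ = (−σ − √(σ² + 4σr))/2. Then λ₁ > λ₂ > λ₃, λ₁ + λ₂ > 0, λ₁ + λ₂ + λ₃ < 0, and the Kaplan–Yorke expression 2 + (λ₁ + λ₂)/|λ₃| equals 3 − 2(σ + b)/(σ + √(σ² + 4σr)). -/
/-- For σ, b, r > 0 with rσ > b(σ + b), the eigenvalues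
λ₁ = (−σ + √(σ² + 4σr))/2, λ₂ = −b, λ₃ = (−σ − √(σ² + 4σr))/2 satisfy λ₁ > λ₂ > λ₃,
λ₁ + λ₂ > 0, λ₁ + λ₂ + λ₃ < 0, and the Kaplan–Yorke expression 2 + (λ₁ + λ₂)/|λ₃|
equals 3 − 2(σ + b)/(σ + √(σ² + 4σr)). -/
theorem yang_kaplan_yorke_dimension
    (σ b r : ℝ) (hσ : 0 < σ) (hb : 0 < b) (hr : 0 < r)
    (h : b * (σ + b) < r * σ)
    (lam₁ lam₂ lam₃ : ℝ)
    (h1 : lam₁ = (-σ + Real.sqrt (σ ^ 2 + 4 * σ * r)) / 2)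
    (h2 : lam₂ = -b)
    (h3 : lam₃ = (-σ - Real.sqrt (σ ^ 2 + 4 * σ * r)) / 2) :
    lam₂ < lam₁ ∧ lam₃ < lam₂ ∧
    0 < lam₁ + lam₂ ∧ lam₁ + lam₂ + lam₃ < 0 ∧
    2 + (lam₁ + lam₂) / |lam₃| =
      3 - 2 * (σ + b) / (σ + Real.sqrt (σ ^ 2 + 4 * σ * r)) := by
  have hS : σ + 2 * b < Real.sqrt (σ ^ 2 + 4 * σ * r) := by
    apply Real.lt_sqrt_of_sq_lt
    linarith [show (σ + 2 * b) ^ 2 = σ ^ 2 + 4 * (b * (σ + b)) by ring]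
  generalize Real.sqrt (σ ^ 2 + 4 * σ * r) = S at *
  have habs : |lam₃| = (σ + S) / 2 := by
    rw [h3, abs_of_neg (by linarith)]
    ring
  refine ⟨by linarith, by linarith, by linarith, by linarith, ?_⟩
  have hpos : σ + S ≠ 0 := by linarith
  rw [habs, h1, h2]
  field_simp
  ring
end
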